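/- arXiv:2003.07824 — 3 statements merged into one kernel-verified Lean document; each statement's English description precedes it below -/
import Mathlib

section
/- Let ν, μ ≥ 0 with μ > 0, α, β ∈ ℝ, and k, m ∈ ℝ with k ≠ 0, and set ξ(x) = k x₁ − m x₃. Consider the non-rotating Boussinesq equations (f = 0) on ℝ³ with a forcing term F(x) = α β cos(ξ) (m, 0, k) added to the right-hand side of the momentum equation. Define v(x) = α cos(ξ) (m, 0, k), p(x) = α (m/k) (β − ν(k² + m²)) sin(ξ), and b(x) = α (ν(k² + m²) − β)(k + m²/k) cos(ξ). Then (v, b, p) is a time-independent solution of the forced system if and only if α = 0 or the stratification satisfies ρ̄′ = μ (k² + m²)(ν(k² + m²) − β)(k² + m²)/k². -/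
noncomputable section

open Real Finset

/-- Partial derivative of a scalar field in coordinate direction `j`. -/
def pd {n : ℕ} (f : (Fin n → ℝ) → ℝ) (j : Fin n) (x : Fin n → ℝ) : ℝ :=
  fderiv ℝ f x (Pi.single j 1)

/-- Euclidean dot product on `Fin n → ℝ`. -/
def dot {n : ℕ} (a b : Fin n → ℝ) : ℝ := ∑ j, a j * b j

/-- Divergence of a vector field. -/
def vdiv {n : ℕ} (v : (Fin n → ℝ) → (Fin n → ℝ)) (x : Fin n → ℝ) : ℝ :=
  ∑ j, pd (fun y => v y j) j x

/-- Advective term `((u·∇)w) i = Σ_j u_j ∂w_i/∂x_j`. -/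
def adv {n : ℕ} (u w : (Fin n → ℝ) → (Fin n → ℝ)) (x : Fin n → ℝ) (i : Fin n) : ℝ :=
  ∑ j, u x j * pd (fun y => w y i) j x

/-- Laplacian of a scalar field. -/
def lap {n : ℕ} (f : (Fin n → ℝ) → ℝ) (x : Fin n → ℝ) : ℝ :=
  ∑ j, pd (fun y => pd f j y) j x

/-- The rotating Boussinesq equations on ℝ³ in the f-plane with momentum forcing `F`:
`∂t v + (v·∇)v + f e₃ × v + ∇p − b e₃ = νΔv + F`, `∇·v = 0`,
`∂t b + (v·∇)b − ρ' v₃ = μΔb`, for `t ≥ 0`. -/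
def IsBoussinesqForced (f ν μ ρ' : ℝ) (v : ℝ → (Fin 3 → ℝ) → (Fin 3 → ℝ))
    (b p : ℝ → (Fin 3 → ℝ) → ℝ) (F : ℝ → (Fin 3 → ℝ) → (Fin 3 → ℝ)) : Prop :=
  ∀ t, 0 ≤ t → ∀ x : Fin 3 → ℝ,
    (∀ i, deriv (fun s => v s x i) t + adv (v t) (v t) x i
        + f * (![-(v t x 1), v t x 0, 0] i) + pd (p t) i x - b t x * (![(0:ℝ), 0, 1] i)
        = ν * lap (fun y => v t y i) x + F t x i)
    ∧ vdiv (v t) x = 0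
    ∧ deriv (fun s => b s x) t + (∑ j, v t x j * pd (b t) j x) - ρ' * v t x 2
        = μ * lap (b t) x

theorem hasFDerivAt_phase (k m : ℝ) (x : Fin 3 → ℝ) :
    HasFDerivAt (fun y : Fin 3 → ℝ => k * y 0 - m * y 2)
      (k • ContinuousLinearMap.proj (R := ℝ) (φ := fun _ : Fin 3 => ℝ) 0
        - m • ContinuousLinearMap.proj (R := ℝ) (φ := fun _ : Fin 3 => ℝ) 2) x :=
  ((hasFDerivAt_apply 0 x).const_mul k).sub ((hasFDerivAt_apply 2 x).const_mul m)

theorem pd_const_mul_cos_phase (A k m : ℝ) (j : Fin 3) (x : Fin 3 → ℝ) :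
    pd (fun y => A * Real.cos (k * y 0 - m * y 2)) j x
      = -A * ![k, 0, -m] j * Real.sin (k * x 0 - m * x 2) := by
  rw [pd, ((hasFDerivAt_phase k m x).cos.const_mul A).fderiv]
  fin_cases j <;> simp <;> ring

theorem pd_const_mul_sin_phase (A k m : ℝ) (j : Fin 3) (x : Fin 3 → ℝ) :
    pd (fun y => A * Real.sin (k * y 0 - m * y 2)) j x
      = A * ![k, 0, -m] j * Real.cos (k * x 0 - m * x 2) := by
  rw [pd, ((hasFDerivAt_phase k m x).sin.const_mul A).fderiv]
  fin_cases j <;> simp <;> ring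

theorem lap_const_mul_cos_phase (A k m : ℝ) (x : Fin 3 → ℝ) :
    lap (fun y => A * Real.cos (k * y 0 - m * y 2)) x
      = -(k ^ 2 + m ^ 2) * A * Real.cos (k * x 0 - m * x 2) := by
  simp only [lap, pd_const_mul_cos_phase, pd_const_mul_sin_phase, Fin.sum_univ_three]
  simp
  ring


/-- With forcing `F = αβ cos(ξ)(m,0,k)`, `ξ = kx₁ − mx₃`, the fields
`v = α cos(ξ)(m,0,k)`, `p = α(m/k)(β − ν(k²+m²)) sin ξ`,
`b = α(ν(k²+m²) − β)(k + m²/k) cos ξ` give a time-independent solution of the forced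
non-rotating Boussinesq system iff `α = 0` or `ρ' = μ(k²+m²)(ν(k²+m²) − β)(k²+m²)/k²`. -/
theorem stmt5 (ν μ α β k m ρ' : ℝ) (hν : 0 ≤ ν) (hμ : 0 < μ) (hk : k ≠ 0) :
    IsBoussinesqForced 0 ν μ ρ'
        (fun _ x i => α * Real.cos (k * x 0 - m * x 2) * (![m, 0, k] i))
        (fun _ x => α * (ν * (k ^ 2 + m ^ 2) - β) * (k + m ^ 2 / k) * Real.cos (k * x 0 - m * x 2))
        (fun _ x => α * (m / k) * (β - ν * (k ^ 2 + m ^ 2)) * Real.sin (k * x 0 - m * x 2))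
        (fun _ x i => α * β * Real.cos (k * x 0 - m * x 2) * (![m, 0, k] i))
      ↔ (α = 0 ∨ ρ' = μ * (k ^ 2 + m ^ 2) * (ν * (k ^ 2 + m ^ 2) - β) * (k ^ 2 + m ^ 2) / k ^ 2) := by
  have hv : ∀ c : ℝ, (fun y : Fin 3 → ℝ => α * Real.cos (k * y 0 - m * y 2) * c)
      = fun y => (α * c) * Real.cos (k * y 0 - m * y 2) := by
    intro c
    funext y
    ring
  simp only [IsBoussinesqForced, adv, vdiv, hv, pd_const_mul_cos_phase, pd_const_mul_sin_phase,
    lap_const_mul_cos_phase, Fin.sum_univ_three, deriv_const]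
  constructor
  · intro h
    have h0 := (h 0 le_rfl 0).2.2
    rw [or_iff_not_imp_left]
    intro hα
    simp at h0
    field_simp at h0 ⊢
    linear_combination -h0
  · intro h t _ x
    refine ⟨fun i => ?_, ?_, ?_⟩
    · fin_cases i <;> simp <;> field_simp <;> ring
    · simp
      ring
    · rcases h with rfl | rfl
      · simp
      · simp
        field_simp
        ring
end
end

section
/- Let n ≥ 2, 1 ≤ N < n, and for 1 ≤ i ≤ N let aᵢ ∈ ℝⁿ, Mᵢ ≥ 1, and for 1 ≤ j ≤ Mᵢ let ψ_{i,j} ∈ C¹(ℝ≥0 × ℝ, ℝ), k_{i,j} ∈ ℝⁿ, ω_{i,j} ∈ ℝ; let c ∈ ℝⁿ. Assume the orthogonality conditions aᵢ·k_{j,ℓ} = 0 for all 1 ≤ ℓ ≤ Mⱼ and all 1 ≤ i, j ≤ N. Then the transverse flow v(t,x) = Σ_{i=1}^N aᵢ Σ_{j=1}^{Mᵢ} ψ_{i,j}(t, k_{i,j}·x − ω_{i,j} t) + c satisfies, for all t and x: (i) ∇·v = 0, and (ii) (v·∇)v = Σ_{i=1}^N aᵢ Σ_{j=1}^{Mᵢ}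 (c·k_{i,j}) ∂ξψ_{i,j}(t, k_{i,j}·x − ω_{i,j} t), where ∂ξ is the derivative in the second (phase) variable. -/
noncomputable section

open Real Finset

theorem hasFDerivAt_dot {n : ℕ} (k x : Fin n → ℝ) :
    HasFDerivAt (fun y => dot k y)
      (∑ m, k m • (ContinuousLinearMap.proj m : (Fin n → ℝ) →L[ℝ] ℝ)) x := by
  unfold dot
  exact HasFDerivAt.fun_sum fun m _ => (hasFDerivAt_apply m x).const_mul (k m)

/-- The derivative of a superposition of plane waves in a coordinate direction. -/
theorem pd_sum_plane_waves {n N : ℕ} {M : Fin N → ℕ}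
    (φ : (i : Fin N) → Fin (M i) → ℝ → ℝ) (hφ : ∀ i j, Differentiable ℝ (φ i j))
    (k : (i : Fin N) → Fin (M i) → Fin n → ℝ) (s : (i : Fin N) → Fin (M i) → ℝ)
    (b : Fin N → ℝ) (c : ℝ) (m : Fin n) (x : Fin n → ℝ) :
    pd (fun y => (∑ i, (∑ j, φ i j (dot (k i j) y - s i j)) * b i) + c) m x
      = ∑ i, (∑ j, k i j m * deriv (φ i j) (dot (k i j) x - s i j)) * b i := by
  have h : HasFDerivAt (fun y => (∑ i, (∑ j, φ i j (dot (k i j) y - s i j)) * b i) + c)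
      (∑ i, b i • ∑ j, deriv (φ i j) (dot (k i j) x - s i j) •
        ∑ l, k i j l • (ContinuousLinearMap.proj l : (Fin n → ℝ) →L[ℝ] ℝ)) x :=
    (HasFDerivAt.fun_sum fun i _ => (HasFDerivAt.fun_sum fun j _ =>
      (hφ i j _).hasDerivAt.comp_hasFDerivAt x
        ((hasFDerivAt_dot (k i j) x).sub_const (s i j))).mul_const (b i)).add_const c
  rw [pd, h.fderiv]
  simp [Pi.single_apply, mul_comm]

theorem sum_mul_sum_plane_waves {n N : ℕ} {M : Fin N → ℕ}
    (u : Fin n → ℝ) (k : (i : Fin N) → Fin (M i) → Fin n → ℝ)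
    (D : (i : Fin N) → Fin (M i) → ℝ) (b : Fin N → ℝ) :
    ∑ m, u m * ∑ i, (∑ j, k i j m * D i j) * b i
      = ∑ i, (∑ j, dot u (k i j) * D i j) * b i := by
  simp only [dot, Finset.mul_sum, Finset.sum_mul]
  rw [Finset.sum_comm]
  refine Finset.sum_congr rfl fun i _ => ?_
  rw [Finset.sum_comm]
  refine Finset.sum_congr rfl fun j _ => Finset.sum_congr rfl fun m _ => ?_
  ring

theorem dot_sum_smul_add {n N : ℕ} (a : Fin N → Fin n → ℝ) (p : Fin N → ℝ) (c κ : Fin n → ℝ)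
    (h : ∀ i, dot (a i) κ = 0) :
    dot (fun d => (∑ i, p i * a i d) + c d) κ = dot c κ := by
  have h' : ∑ m, (∑ i, p i * a i m) * κ m = ∑ i, p i * dot (a i) κ := by
    simp only [dot, Finset.mul_sum, Finset.sum_mul]
    rw [Finset.sum_comm]
    simp only [mul_assoc]
  simp only [h, mul_zero, Finset.sum_const_zero] at h'
  simp only [dot, add_mul, Finset.sum_add_distrib, h', zero_add]

/-- The transverse flow
`v(t,x) = Σᵢ aᵢ Σⱼ ψ_{i,j}(t, k_{i,j}·x − ω_{i,j}t) + c` with the orthogonality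
conditions `aᵢ·k_{j,ℓ} = 0` satisfies `∇·v = 0` and
`(v·∇)v = Σᵢ aᵢ Σⱼ (c·k_{i,j}) ∂ξψ_{i,j}`. -/
theorem stmt12 (n N : ℕ) (hn : 2 ≤ n) (hN1 : 1 ≤ N) (hNn : N < n)
    (a : Fin N → Fin n → ℝ) (M : Fin N → ℕ) (hM : ∀ i, 1 ≤ M i)
    (ψ : (i : Fin N) → Fin (M i) → ℝ → ℝ → ℝ)
    (hψ : ∀ i j, ContDiff ℝ 1 (Function.uncurry (ψ i j)))
    (k : (i : Fin N) → Fin (M i) → Fin n → ℝ)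
    (ω : (i : Fin N) → Fin (M i) → ℝ) (c : Fin n → ℝ)
    (horth : ∀ (i j : Fin N) (l : Fin (M j)), dot (a i) (k j l) = 0)
    (v : ℝ → (Fin n → ℝ) → (Fin n → ℝ))
    (hv : ∀ t x d, v t x d
      = (∑ i, (∑ j, ψ i j t (dot (k i j) x - ω i j * t)) * a i d) + c d) :
    ∀ t, 0 ≤ t → ∀ x : Fin n → ℝ,
      vdiv (v t) x = 0
      ∧ ∀ d, adv (v t) (v t) x d
          = ∑ i, (∑ j, dot c (k i j) * deriv (ψ i j t) (dot (k i j) x - ω i j * t)) * a i d := by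
  intro t _ x
  have hφ : ∀ i j, Differentiable ℝ (ψ i j t) := fun i j =>
    ((hψ i j).differentiable one_ne_zero).comp
      ((differentiable_const t).prodMk differentiable_id)
  have hpd : ∀ d m, pd (fun y => v t y d) m x
      = ∑ i, (∑ j, k i j m * deriv (ψ i j t) (dot (k i j) x - ω i j * t)) * a i d := by
    intro d m
    simp only [hv]
    exact pd_sum_plane_waves (fun i j => ψ i j t) hφ k (fun i j => ω i j * t)
      (fun i => a i d) (c d) m x
  refine ⟨?_, fun d => ?_⟩
  · simp only [vdiv, hpd]
    rw [Finset.sum_comm]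
    refine Finset.sum_eq_zero fun i _ => ?_
    simp only [Finset.sum_mul]
    rw [Finset.sum_comm]
    refine Finset.sum_eq_zero fun j _ => ?_
    have h := congrArg (· * deriv (ψ i j t) (dot (k i j) x - ω i j * t)) (horth i i j)
    simp only [dot, Finset.sum_mul, zero_mul] at h
    rw [← h]
    exact Finset.sum_congr rfl fun m _ => by simp only [dot]; ring
  · simp only [adv, hpd]
    rw [sum_mul_sum_plane_waves (v t x) k]
    have hdot : ∀ i j, dot (v t x) (k i j) = dot c (k i j) := by
      intro i j
      rw [show v t x = _ from funext fun d => hv t x d]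
      exact dot_sum_smul_add a _ c _ fun l => horth l i j
    simp only [hdot]
end
end

section
/- Let n ≥ 2, N ≥ 1, and for 1 ≤ i ≤ N let ψᵢ ∈ C¹(ℝ≥0 × ℝ, ℝ), kᵢ ∈ ℝⁿ, ωᵢ ∈ ℝ; let c ∈ ℝⁿ. Define v(t,x) = Σ_{i=1}^N ψᵢ(t, kᵢ·x − ωᵢ t) kᵢ + c (each wave's flow direction equal to its own wave vector). Then the advective term satisfies (v·∇)v = Σ_{i=1}^N (c·kᵢ) ∂ξψᵢ(t, kᵢ·x − ωᵢ t) kᵢ + ∇h(t,x), where h(t,x) = (1/2) Σ_{i=1}^N Σ_{j=1}^N (kᵢ·kⱼ) ψᵢ(t, kᵢ·x − ωᵢ t) ψⱼ(t, kⱼ·x − ωⱼ t) and ∂ξ denotes the derivative in the phase variable. -/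
noncomputable section

open Real Finset

theorem dot_comm {n : ℕ} (a b : Fin n → ℝ) : dot a b = dot b a :=
  Finset.sum_congr rfl fun _ _ => mul_comm _ _

/-- The linear functional `y ↦ dot a y`. -/
def dotCLM {n : ℕ} (a : Fin n → ℝ) : (Fin n → ℝ) →L[ℝ] ℝ :=
  ∑ j, a j • ContinuousLinearMap.proj j

theorem dotCLM_apply {n : ℕ} (a y : Fin n → ℝ) : dotCLM a y = dot a y := by
  simp [dotCLM, dot]

theorem dotCLM_single {n : ℕ} (a : Fin n → ℝ) (j : Fin n) :
    dotCLM a (Pi.single j 1) = a j := by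
  simp [dotCLM_apply, dot, Pi.single_apply]

theorem hasFDerivAt_planeWave {n : ℕ} {f : ℝ → ℝ} (hf : Differentiable ℝ f)
    (a : Fin n → ℝ) (s : ℝ) (x : Fin n → ℝ) :
    HasFDerivAt (fun y => f (dot a y - s)) (deriv f (dot a x - s) • dotCLM a) x := by
  have hphase : HasFDerivAt (fun y => dot a y - s) (dotCLM a) x := by
    simpa only [dotCLM_apply] using ((dotCLM a).hasFDerivAt (x := x)).sub_const s
  exact (hf _).hasDerivAt.comp_hasFDerivAt x hphase

/-- Partial derivative of a component of a superposition of plane waves. -/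
theorem pd_sum_planeWave {n N : ℕ} {f : Fin N → ℝ → ℝ} (hf : ∀ i, Differentiable ℝ (f i))
    (a : Fin N → Fin n → ℝ) (s b : Fin N → ℝ) (c : ℝ) (j : Fin n) (x : Fin n → ℝ) :
    pd (fun y => (∑ i, f i (dot (a i) y - s i) * b i) + c) j x
      = ∑ i, deriv (f i) (dot (a i) x - s i) * a i j * b i := by
  have hderiv := (HasFDerivAt.fun_sum (u := Finset.univ) fun i _ =>
    (hasFDerivAt_planeWave (hf i) (a i) (s i) x).mul_const (b i)).add_const c
  rw [pd, hderiv.fderiv]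
  simp only [_root_.sum_apply, smul_apply, dotCLM_single,
    smul_eq_mul]
  exact Finset.sum_congr rfl fun i _ => by ring

/-- Partial derivative of a symmetric quadratic form in plane waves. -/
theorem pd_quadratic_planeWave {n N : ℕ} {f : Fin N → ℝ → ℝ}
    (hf : ∀ i, Differentiable ℝ (f i)) (a : Fin N → Fin n → ℝ) (s : Fin N → ℝ)
    {G : Fin N → Fin N → ℝ} (hG : ∀ i j, G i j = G j i) (d : Fin n) (x : Fin n → ℝ) :
    pd (fun y => (1 / 2) * ∑ i, ∑ j,
        G i j * f i (dot (a i) y - s i) * f j (dot (a j) y - s j)) d x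
      = ∑ i, ∑ j, G i j * (deriv (f i) (dot (a i) x - s i) * a i d)
          * f j (dot (a j) x - s j) := by
  have hderiv := (HasFDerivAt.fun_sum (u := Finset.univ) fun i _ =>
    HasFDerivAt.fun_sum (u := Finset.univ) fun j _ =>
      ((hasFDerivAt_planeWave (hf i) (a i) (s i) x).const_mul (G i j)).mul
        (hasFDerivAt_planeWave (hf j) (a j) (s j) x)).const_mul (1 / 2)
  refine (congrArg (fun L => L (Pi.single d 1)) hderiv.fderiv).trans ?_
  simp only [_root_.sum_apply, smul_apply,
    add_apply, dotCLM_single, smul_eq_mul, Finset.sum_add_distrib]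
  have hswap : ∑ i, ∑ j, G i j * f i (dot (a i) x - s i)
        * (deriv (f j) (dot (a j) x - s j) * a j d)
      = ∑ i, ∑ j, G i j * (deriv (f i) (dot (a i) x - s i) * a i d)
          * f j (dot (a j) x - s j) := by
    rw [Finset.sum_comm]
    refine Finset.sum_congr rfl fun i _ => Finset.sum_congr rfl fun j _ => ?_
    rw [hG j i]; ring
  have hcomm : ∑ i, ∑ j, f j (dot (a j) x - s j)
        * (G i j * (deriv (f i) (dot (a i) x - s i) * a i d))
      = ∑ i, ∑ j, G i j * (deriv (f i) (dot (a i) x - s i) * a i d)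
          * f j (dot (a j) x - s j) :=
    Finset.sum_congr rfl fun i _ => Finset.sum_congr rfl fun j _ => mul_comm _ _
  rw [hswap, hcomm]; ring

theorem dot_sum_mul_add {n N : ℕ} (p : Fin N → ℝ) (a : Fin N → Fin n → ℝ) (c b : Fin n → ℝ) :
    dot (fun j => (∑ i, p i * a i j) + c j) b = (∑ i, p i * dot (a i) b) + dot c b := by
  simp only [dot, add_mul, Finset.sum_add_distrib, Finset.sum_mul, Finset.mul_sum, mul_assoc]
  rw [Finset.sum_comm]

/-- For `v(t,x) = Σᵢ ψᵢ(t, kᵢ·x − ωᵢt) kᵢ + c` (each wave's flow direction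
equal to its own wave vector), the advective term satisfies
`(v·∇)v = Σᵢ (c·kᵢ) ∂ξψᵢ kᵢ + ∇h`, where
`h = (1/2) Σᵢ Σⱼ (kᵢ·kⱼ) ψᵢ ψⱼ`. -/
theorem stmt15 (n N : ℕ) (hn : 2 ≤ n) (hN : 1 ≤ N)
    (ψ : Fin N → ℝ → ℝ → ℝ) (hψ : ∀ i, ContDiff ℝ 1 (Function.uncurry (ψ i)))
    (k : Fin N → Fin n → ℝ) (ω : Fin N → ℝ) (c : Fin n → ℝ)
    (v : ℝ → (Fin n → ℝ) → (Fin n → ℝ))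
    (hv : ∀ t x d, v t x d = (∑ i, ψ i t (dot (k i) x - ω i * t) * k i d) + c d)
    (h : ℝ → (Fin n → ℝ) → ℝ)
    (hh : ∀ t x, h t x = (1 / 2) * ∑ i, ∑ j,
        dot (k i) (k j) * ψ i t (dot (k i) x - ω i * t) * ψ j t (dot (k j) x - ω j * t)) :
    ∀ t, 0 ≤ t → ∀ x : Fin n → ℝ, ∀ d,
      adv (v t) (v t) x d
        = (∑ i, dot c (k i) * deriv (ψ i t) (dot (k i) x - ω i * t) * k i d)
          + pd (h t) d x := by
  intro t _ x d
  have hf : ∀ i, Differentiable ℝ (ψ i t) := fun i =>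
    ((hψ i).differentiable one_ne_zero).comp
      ((differentiable_const t).prodMk differentiable_id)
  have hvd : (fun y => v t y d)
      = fun y => (∑ i, ψ i t (dot (k i) y - ω i * t) * k i d) + c d :=
    funext fun y => hv t y d
  have hvx : v t x = fun j => (∑ i, ψ i t (dot (k i) x - ω i * t) * k i j) + c j :=
    funext fun j => hv t x j
  have hadv : adv (v t) (v t) x d
      = ∑ i, deriv (ψ i t) (dot (k i) x - ω i * t) * k i d * dot (v t x) (k i) := by
    simp only [adv, hvd, pd_sum_planeWave hf k (fun i => ω i * t) (fun i => k i d)]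
    simp only [Finset.mul_sum, dot.eq_1 (v t x)]
    rw [Finset.sum_comm]
    exact Finset.sum_congr rfl fun i _ => Finset.sum_congr rfl fun j _ => by ring
  rw [hadv, show h t = _ from funext (hh t),
    pd_quadratic_planeWave hf k (fun i => ω i * t) (fun i j => dot_comm (k i) (k j)),
    ← Finset.sum_add_distrib]
  refine Finset.sum_congr rfl fun i _ => ?_
  rw [hvx, dot_sum_mul_add, mul_add, Finset.mul_sum, add_comm]
  congr 1
  · ring
  · refine Finset.sum_congr rfl fun j _ => ?_
    rw [dot_comm (k j) (k i)]; ring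
end
end
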